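/- Let d_w, d_v be positive integers and let X, Y be real d_w × d_v matrices. Then cov(X, Y) = (64/π⁴)·Σ_{m=1}^∞ Σ_{n=1}^∞ [κ_b(√(m² + n²)·(X−Y)) − κ_b(m·(X−Y))·κ_b(n·(X−Y))] / ((4m² − 1)(4n² − 1)). -/

import Mathlib

open MeasureTheory ProbabilityTheory Matrix Real

/-- Standard Gaussian measure on ℝ^d (i.i.d. N(0,1) entries). -/
noncomputable def stdGaussian (d : ℕ) : Measure (Fin d → ℝ) :=
  Measure.pi fun _ => ProbabilityTheory.gaussianReal 0 1

/-- Uniform probability measure on the interval [a, b]. -/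
noncomputable def unifIcc (a b : ℝ) : Measure ℝ :=
  (ENNReal.ofReal (b - a))⁻¹ • MeasureTheory.volume.restrict (Set.Icc a b)

/-- κ_b(A) = det(I + A Aᵀ)^(−1/2). -/
noncomputable def kb {dw dv : ℕ} (A : Matrix (Fin dw) (Fin dv) ℝ) : ℝ :=
  (Matrix.det (1 + A * Aᵀ)) ^ (-(1 / 2 : ℝ))

/-- Gaussian kernel κ_g(A) = exp(−‖A‖_F²/2). -/
noncomputable def kg {dw dv : ℕ} (A : Matrix (Fin dw) (Fin dv) ℝ) : ℝ :=
  Real.exp (-(∑ i, ∑ j, (A i j) ^ 2) / 2)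

/-- Binary quantizer sgn(z) = 1 if z ≥ 0, else 0. -/
noncomputable def sgn01 (z : ℝ) : ℝ := if 0 ≤ z then 1 else 0

/-- Joint law of (w, v₁, v₂, b₁, b₂, t₁, t₂):
w ~ N(0, I_{d_w}), v₁, v₂ ~ N(0, I_{d_v}), b₁, b₂ ~ Unif[0, 2π],
t₁, t₂ ~ Unif[−1, 1], all mutually independent. -/
noncomputable def hashLaw2 (dw dv : ℕ) :
    Measure ((Fin dw → ℝ) × (Fin dv → ℝ) × (Fin dv → ℝ) × ℝ × ℝ × ℝ × ℝ) :=
  (stdGaussian dw).prod ((stdGaussian dv).prod ((stdGaussian dv).prod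
    ((unifIcc 0 (2 * π)).prod ((unifIcc 0 (2 * π)).prod
      ((unifIcc (-1) 1).prod (unifIcc (-1) 1))))))

/-- First hash bit h₁(X) = sgn(cos(wᵀ X v₁ + b₁) + t₁): shares w with h₂. -/
noncomputable def hashBit1 {dw dv : ℕ} (X : Matrix (Fin dw) (Fin dv) ℝ)
    (p : (Fin dw → ℝ) × (Fin dv → ℝ) × (Fin dv → ℝ) × ℝ × ℝ × ℝ × ℝ) : ℝ :=
  sgn01 (Real.cos (p.1 ⬝ᵥ (X *ᵥ p.2.1) + p.2.2.2.1) + p.2.2.2.2.2.1)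

/-- Second hash bit h₂(X) = sgn(cos(wᵀ X v₂ + b₂) + t₂): shares w with h₁. -/
noncomputable def hashBit2 {dw dv : ℕ} (X : Matrix (Fin dw) (Fin dv) ℝ)
    (p : (Fin dw → ℝ) × (Fin dv → ℝ) × (Fin dv → ℝ) × ℝ × ℝ × ℝ × ℝ) : ℝ :=
  sgn01 (Real.cos (p.1 ⬝ᵥ (X *ᵥ p.2.2.1) + p.2.2.2.2.1) + p.2.2.2.2.2.2)

/-- Covariance between the two bits:
cov(X,Y) = P(h₁(X)≠h₁(Y) ∧ h₂(X)≠h₂(Y)) − P(h₁(X)≠h₁(Y))·P(h₂(X)≠h₂(Y)). -/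
noncomputable def bitCov {dw dv : ℕ} (X Y : Matrix (Fin dw) (Fin dv) ℝ) : ℝ :=
  (hashLaw2 dw dv
      {p | hashBit1 X p ≠ hashBit1 Y p ∧ hashBit2 X p ≠ hashBit2 Y p}).toReal -
    (hashLaw2 dw dv {p | hashBit1 X p ≠ hashBit1 Y p}).toReal *
      (hashLaw2 dw dv {p | hashBit2 X p ≠ hashBit2 Y p}).toReal


lemma deriv_aux (n : ℤ) (x : ℝ) :
    HasDerivAt (fun x : ℝ => Complex.exp (-(n * x * Complex.I)) *
      ((2 / (4 * (n:ℂ)^2 - 1)) * Complex.cos (x/2) + (2 / (4 * (n:ℂ)^2 - 1)) * (2 * n * Complex.I) * Complex.sin (x/2)))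
     (Complex.exp (-(n * x * Complex.I)) * Complex.sin (x/2)) x := by
  have hn : (4 * (n:ℂ)^2 - 1) ≠ 0 := by
    have : (4 * n^2 - 1 : ℤ) ≠ 0 := by omega
    exact_mod_cast this
  have h : HasDerivAt (fun z : ℂ => Complex.exp (-(n * z * Complex.I)) *
      ((2 / (4 * (n:ℂ)^2 - 1)) * Complex.cos (z/2) + (2 / (4 * (n:ℂ)^2 - 1)) * (2 * n * Complex.I) * Complex.sin (z/2)))
     (Complex.exp (-(n * x * Complex.I)) * Complex.sin (x/2)) (x:ℂ) := by
    have h1 : HasDerivAt (fun z : ℂ => Complex.exp (-(n * z * Complex.I))) (Complex.exp (-(n * x * Complex.I)) * (-(n * 1 * Complex.I))) (x:ℂ) :=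
      ((((hasDerivAt_id (x:ℂ)).const_mul (n:ℂ)).mul_const Complex.I).neg).cexp
    have h2 : HasDerivAt (fun z : ℂ => Complex.cos (z/2)) (-Complex.sin (x/2) * (1/2)) (x:ℂ) :=
      ((hasDerivAt_id (x:ℂ)).div_const 2).ccos
    have h3 : HasDerivAt (fun z : ℂ => Complex.sin (z/2)) (Complex.cos (x/2) * (1/2)) (x:ℂ) :=
      ((hasDerivAt_id (x:ℂ)).div_const 2).csin
    have := h1.mul ((h2.const_mul (2 / (4 * (n:ℂ)^2 - 1))).add (h3.const_mul ((2 / (4 * (n:ℂ)^2 - 1)) * (2 * n * Complex.I))))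
    refine this.congr_deriv ?_
    simp only [Pi.add_apply]
    have hc : 2 / (4 * (n:ℂ)^2 - 1) * (4 * (n:ℂ)^2 - 1) = 2 := by field_simp
    generalize 2 / (4 * (n:ℂ)^2 - 1) = c at *
    linear_combination (Complex.exp (-(n * x * Complex.I)) * Complex.sin (x/2) / 2) * hc - 2 * (n:ℂ)^2 * c * Complex.sin (x/2) * Complex.exp (-(n * x * Complex.I)) * Complex.I_sq
  exact h.comp_ofReal

lemma int_aux (n : ℤ) : ∫ x in (0:ℝ)..(2*π), (Complex.exp (-(n * x * Complex.I)) * Complex.sin (x/2)) = -4 / (4 * (n:ℂ)^2 - 1) := by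
  rw [intervalIntegral.integral_eq_sub_of_hasDerivAt (fun x _ => deriv_aux n x)]
  · have : Complex.exp (-(n * (2 * π) * Complex.I)) = 1 := by
      rw [Complex.exp_eq_one_iff]; exact ⟨-n, by push_cast; ring⟩
    push_cast
    rw [this]
    have h2 : (2 * (π:ℂ) / 2) = π := by ring
    rw [h2]
    simp
    ring
  · apply Continuous.intervalIntegrable; fun_prop

noncomputable def absSinLift : AddCircle (2*π) → ℂ :=
  Function.Periodic.lift (f := fun x : ℝ => ((|Real.sin (x/2)| : ℝ) : ℂ)) (c := 2*π) (by
    intro x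
    have : (x + 2*π)/2 = x/2 + π := by ring
    simp [this, Real.sin_add_pi])

lemma absSinLift_cont : Continuous absSinLift := by
  apply continuous_coinduced_dom.mpr
  show Continuous (fun x : ℝ => ((|Real.sin (x/2)| : ℝ) : ℂ))
  fun_prop

noncomputable def absSinC : C(AddCircle (2*π), ℂ) := ⟨absSinLift, absSinLift_cont⟩

lemma absSinC_apply (x : ℝ) : absSinC (x : AddCircle (2*π)) = ((|Real.sin (x/2)| : ℝ) : ℂ) := rfl

instance fact2pi : Fact (0 < 2 * π) := ⟨by positivity⟩

lemma coeff_aux (n : ℤ) : fourierCoeff absSinC n = ((-2 / (π * (4 * (n:ℝ)^2 - 1)) : ℝ) : ℂ) := by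
  rw [fourierCoeff_eq_intervalIntegral _ n 0, zero_add]
  have : ∫ x in (0:ℝ)..(2*π), (fourier (-n) (x : AddCircle (2*π))) • absSinC (x : AddCircle (2*π)) =
      ∫ x in (0:ℝ)..(2*π), (Complex.exp (-(n * x * Complex.I)) * Complex.sin (x/2)) := by
    apply intervalIntegral.integral_congr
    intro x hx
    rw [Set.uIcc_of_le (by positivity)] at hx
    simp only [absSinC_apply, fourier_coe_apply, smul_eq_mul]
    rw [abs_of_nonneg (Real.sin_nonneg_of_nonneg_of_le_pi (by linarith [hx.1]) (by linarith [hx.2]))]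
    push_cast
    congr 2
    have : (π:ℂ) ≠ 0 := by exact_mod_cast pi_ne_zero
    field_simp
  rw [this, int_aux]
  have : (π:ℂ) ≠ 0 := by exact_mod_cast pi_ne_zero
  have hn : (4 * (n:ℂ)^2 - 1) ≠ 0 := by
    have : (4 * n^2 - 1 : ℤ) ≠ 0 := by omega
    exact_mod_cast this
  rw [Complex.real_smul]
  push_cast
  field_simp
  norm_num

lemma den_pos (m : ℕ+) : (0:ℝ) < 4 * (m:ℝ)^2 - 1 := by
  have : (1:ℝ) ≤ m := by exact_mod_cast one_le
  nlinarith

lemma summ_int : Summable (fun n : ℤ => (1 / (4 * (n:ℝ)^2 - 1))) := by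
  have h : Summable (fun n : ℤ => 1 / (n:ℝ)^2) := Real.summable_one_div_int_pow.mpr (by norm_num)
  have h' : Summable (fun n : ℤ => 1 / (n:ℝ)^2 + if n = 0 then 1 else 0) :=
    h.add (hasSum_ite_eq 0 1).summable
  refine Summable.of_norm_bounded h' fun n => ?_
  by_cases hn : n = 0
  · subst hn; simp
  · have h1 : (1:ℝ) ≤ (n:ℝ)^2 := by
      have : 1 ≤ n^2 := by have := sq_nonneg n; have : n^2 ≠ 0 := by positivity
                           omega
      exact_mod_cast this
    rw [Real.norm_of_nonneg (by apply div_nonneg <;> linarith), if_neg hn, add_zero]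
    apply one_div_le_one_div_of_le <;> linarith

lemma summ_pnat : Summable (fun m : ℕ+ => (1 / (4 * (m:ℝ)^2 - 1))) := by
  have := summ_int.comp_injective (i := fun m : ℕ+ => (m : ℤ)) (fun a b h => by simpa using h)
  exact this.congr fun m => by simp

lemma fourier_abs_sin (x : ℝ) : HasSum (fun m : ℕ+ => Real.cos (m * x) / (4 * (m:ℝ)^2 - 1))
    (1/2 - π/4 * |Real.sin (x/2)|) := by
  have hs : Summable (fourierCoeff absSinC) := by
    have : fourierCoeff absSinC = fun n : ℤ => (((-2/π) * (1 / (4 * (n:ℝ)^2 - 1)) : ℝ) : ℂ) := by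
      ext n; rw [coeff_aux]; congr 1; simp only [div_eq_mul_inv, mul_inv]; ring
    rw [this]
    exact (Complex.hasSum_ofReal.mpr ((summ_int.mul_left (-2/π)).hasSum)).summable
  have h := has_pointwise_sum_fourier_series_of_summable hs (x : AddCircle (2*π))
  rw [absSinC_apply] at h
  have h2 := Complex.hasSum_re h
  have e : ∀ n : ℤ, (fourierCoeff absSinC n • fourier n (x : AddCircle (2*π))).re = -2 / (π * (4 * (n:ℝ)^2 - 1)) * Real.cos (n * x) := by
    intro n
    rw [coeff_aux, fourier_coe_apply, smul_eq_mul, Complex.re_ofReal_mul]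
    congr 1
    have : (2 * π * Complex.I * n * x / ((2 * π : ℝ):ℂ)) = ((n * x : ℝ) : ℂ) * Complex.I := by
      have : (π:ℂ) ≠ 0 := by exact_mod_cast pi_ne_zero
      push_cast; field_simp
    rw [this, Complex.exp_ofReal_mul_I_re]
  simp only [e, Complex.ofReal_re] at h2
  have h3 := (h2.nat_add_neg).update 0 0
  have h4 : HasSum (fun m : ℕ+ => -2 / (π * (4 * (m:ℝ)^2 - 1)) * Real.cos (m * x) + -2 / (π * (4 * (m:ℝ)^2 - 1)) * Real.cos (m * x))
    (|Real.sin (x/2)| - 2/π) := by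
    have := (PNat.coe_injective.hasSum_iff (f := _) ?_).mpr h3
    · convert! this using 1
      · ext m
        simp
      · simp; field_simp; ring
    · intro k hk
      have : k = 0 := by
        by_contra h0
        exact hk ⟨⟨k, Nat.pos_of_ne_zero h0⟩, rfl⟩
      subst this; simp
  have h5 := h4.mul_left (-π/4)
  convert! h5 using 1
  · ext m
    have := den_pos m
    field_simp
    ring
  · field_simp; ring

open scoped MatrixOrder in
lemma exists_factor {d e : ℕ} (Z : Matrix (Fin d) (Fin e) ℝ) :
    ∃ B : Matrix (Fin d) (Fin d) ℝ, B.det ≠ 0 ∧ 1 + Z * Zᵀ = Bᵀ * B := by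
  have h : (1 + Z * Zᵀ).PosDef := by
    refine Matrix.PosDef.one.add_posSemidef ?_
    have := Matrix.posSemidef_self_mul_conjTranspose Z
    simpa using this
  obtain ⟨y, hy, e⟩ := CStarAlgebra.isStrictlyPositive_iff_eq_star_mul_self.mp h.isStrictlyPositive
  refine ⟨y, ?_, ?_⟩
  · exact ((Matrix.isUnit_iff_isUnit_det y).mp hy).ne_zero
  · rw [e, Matrix.star_eq_conjTranspose, Matrix.conjTranspose_eq_transpose_of_trivial]

noncomputable def gpdf {d : ℕ} (w : Fin d → ℝ) : ℝ := ∏ i, gaussianPDFReal 0 1 (w i)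

lemma gpdf_eq {d : ℕ} (w : Fin d → ℝ) : gpdf w = ((√(2 * π))⁻¹) ^ d * Real.exp (-(w ⬝ᵥ w) / 2) := by
  simp only [gpdf, gaussianPDFReal, dotProduct]
  rw [Finset.prod_mul_distrib, ← Real.exp_sum]
  simp [← pow_two, Finset.sum_div, neg_div]

lemma gpdf_integrable {d : ℕ} : Integrable (gpdf (d := d)) volume :=
  Integrable.fintype_prod (fun _ => integrable_gaussianPDFReal 0 1)

lemma gpdf_nonneg {d : ℕ} (w : Fin d → ℝ) : 0 ≤ gpdf w :=
  Finset.prod_nonneg fun i _ => gaussianPDFReal_nonneg 0 1 _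

lemma gpdf_meas {d : ℕ} : Measurable (gpdf (d := d)) := by
  unfold gpdf; fun_prop

lemma stdGaussian_density (d : ℕ) :
    _root_.stdGaussian d = (volume : Measure (Fin d → ℝ)).withDensity (fun w => ENNReal.ofReal (gpdf w)) := by
  unfold _root_.stdGaussian
  apply Measure.pi_eq
  intro s hs
  rw [withDensity_apply _ (MeasurableSet.univ_pi hs),
    ← ofReal_integral_eq_lintegral_ofReal gpdf_integrable.integrableOn (ae_of_all _ gpdf_nonneg),
    volume_pi, Measure.restrict_pi_pi]
  unfold gpdf
  rw [integral_fintype_prod_eq_prod (f := fun _ => gaussianPDFReal 0 1), ENNReal.ofReal_prod_of_nonneg]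
  · refine Finset.prod_congr rfl fun i _ => ?_
    rw [gaussianReal_apply_eq_integral _ one_ne_zero]
  · intro i _
    exact integral_nonneg fun x => gaussianPDFReal_nonneg 0 1 _

lemma integral_stdGaussian {d : ℕ} (f : (Fin d → ℝ) → ℝ) :
    ∫ w, f w ∂(_root_.stdGaussian d) = ∫ w, gpdf w * f w := by
  rw [stdGaussian_density, integral_withDensity_eq_integral_toReal_smul
    (gpdf_meas.ennreal_ofReal) (ae_of_all _ fun _ => ENNReal.ofReal_lt_top)]
  simp [ENNReal.toReal_ofReal (gpdf_nonneg _)]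

instance isProb_std (d : ℕ) : IsProbabilityMeasure (_root_.stdGaussian d) := by
  unfold _root_.stdGaussian; infer_instance

lemma integral_gpdf (d : ℕ) : ∫ w : Fin d → ℝ, gpdf w = 1 := by
  have := integral_stdGaussian (d := d) (fun _ => 1)
  simpa using this.symm

lemma gauss_quad {d e : ℕ} (Z : Matrix (Fin d) (Fin e) ℝ) :
    ∫ w, Real.exp (-((w ᵥ* Z) ⬝ᵥ (w ᵥ* Z)) / 2) ∂(_root_.stdGaussian d) = kb Z := by
  obtain ⟨B, hB, e⟩ := exists_factor Z
  rw [integral_stdGaussian]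
  have h1 : ∀ w : Fin d → ℝ, gpdf w * Real.exp (-((w ᵥ* Z) ⬝ᵥ (w ᵥ* Z)) / 2) = gpdf (Matrix.toLin' B w) := by
    intro w
    rw [gpdf_eq, gpdf_eq, mul_assoc, ← Real.exp_add]
    congr 2
    have h2 : w ⬝ᵥ ((1 + Z * Zᵀ) *ᵥ w) = w ⬝ᵥ w + (w ᵥ* Z) ⬝ᵥ (w ᵥ* Z) := by
      rw [Matrix.add_mulVec, Matrix.one_mulVec, dotProduct_add, ← Matrix.mulVec_mulVec,
        Matrix.mulVec_transpose, Matrix.dotProduct_mulVec]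
    have h3 : w ⬝ᵥ ((1 + Z * Zᵀ) *ᵥ w) = (B *ᵥ w) ⬝ᵥ (B *ᵥ w) := by
      rw [e, ← Matrix.mulVec_mulVec, Matrix.dotProduct_mulVec, Matrix.vecMul_transpose]
    rw [Matrix.toLin'_apply, ← h3, h2]
    ring
  simp_rw [h1]
  have hm : Measurable (Matrix.toLin' B) := (LinearMap.continuous_on_pi _).measurable
  rw [← integral_map (f := gpdf) hm.aemeasurable gpdf_meas.aestronglyMeasurable,
    Real.map_matrix_volume_pi_eq_smul_volume_pi hB, integral_smul_measure, integral_gpdf]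
  unfold kb
  rw [e, Matrix.det_mul, Matrix.det_transpose, Real.rpow_neg (mul_self_nonneg _), ← Real.sqrt_eq_rpow,
    Real.sqrt_mul_self_eq_abs]
  simp [abs_inv]

lemma gauss_cos {d : ℕ} (u : Fin d → ℝ) :
    ∫ v, Real.cos (u ⬝ᵥ v) ∂(_root_.stdGaussian d) = Real.exp (-(u ⬝ᵥ u) / 2) := by
  have h : ∫ v, Complex.exp ((u ⬝ᵥ v : ℝ) * Complex.I) ∂(_root_.stdGaussian d) = ((Real.exp (-(u ⬝ᵥ u) / 2) : ℝ) : ℂ) := by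
    have : ∀ v : Fin d → ℝ, Complex.exp ((u ⬝ᵥ v : ℝ) * Complex.I) = ∏ i, Complex.exp (u i * v i * Complex.I) := by
      intro v
      rw [← Complex.exp_sum]
      simp [dotProduct, Finset.sum_mul]
    simp_rw [this]
    unfold _root_.stdGaussian
    rw [integral_fintype_prod_eq_prod (f := fun i x => Complex.exp (u i * (x:ℝ) * Complex.I))]
    simp_rw [← charFun_apply_real, charFun_gaussianReal]
    rw [← Complex.exp_sum]
    simp [dotProduct, Finset.sum_div, ← pow_two, neg_div]
  have h2 : Integrable (fun v => Complex.exp ((u ⬝ᵥ v : ℝ) * Complex.I)) (_root_.stdGaussian d) := by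
    refine Integrable.of_bound (C := 1) ?_ (ae_of_all _ fun v => ?_)
    · apply Continuous.aestronglyMeasurable
      unfold dotProduct
      fun_prop
    · simp [Complex.norm_exp_ofReal_mul_I]
  have h3 := congrArg Complex.re h
  rw [Complex.ofReal_re] at h3
  rw [← h3]
  have h4 := integral_re h2
  simp only [RCLike.re_eq_complex_re, Complex.exp_ofReal_mul_I_re] at h4
  exact h4

instance isProb_unif1 : IsProbabilityMeasure (unifIcc (-1) 1) := by
  constructor
  simp only [unifIcc, Measure.smul_apply, Measure.restrict_apply MeasurableSet.univ, Set.univ_inter, Real.volume_Icc, smul_eq_mul]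
  exact ENNReal.inv_mul_cancel (by norm_num) ENNReal.ofReal_ne_top

instance isProb_unif2 : IsProbabilityMeasure (unifIcc 0 (2 * π)) := by
  constructor
  simp only [unifIcc, Measure.smul_apply, Measure.restrict_apply MeasurableSet.univ, Set.univ_inter, Real.volume_Icc, smul_eq_mul]
  refine ENNReal.inv_mul_cancel ?_ ENNReal.ofReal_ne_top
  have := pi_pos
  simpa using this

lemma sgn01_meas : Measurable sgn01 :=
  Measurable.ite measurableSet_Ici measurable_const measurable_const

lemma sgn_set (a c : ℝ) : {t | sgn01 (a + t) ≠ sgn01 (c + t)} = Set.Ico (-(max a c)) (-(min a c)) := by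
  ext t
  simp only [sgn01, Set.mem_ofPred_eq, Set.mem_Ico]
  rcases le_total a c with h | h
  · rw [max_eq_right h, min_eq_left h]
    split_ifs <;> constructor <;> intro h' <;> grind
  · rw [max_eq_left h, min_eq_right h]
    split_ifs <;> constructor <;> intro h' <;> grind

lemma t_int (a c : ℝ) (ha : |a| ≤ 1) (hc : |c| ≤ 1) :
    unifIcc (-1) 1 {t | sgn01 (a + t) ≠ sgn01 (c + t)} = ENNReal.ofReal (|a - c| / 2) := by
  rw [abs_le] at ha hc
  rw [sgn_set, unifIcc, Measure.smul_apply, Measure.restrict_apply measurableSet_Ico,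
    Set.inter_eq_left.mpr, Real.volume_Ico, smul_eq_mul]
  · rw [← ENNReal.ofReal_inv_of_pos (by norm_num), ← ENNReal.ofReal_mul (by norm_num)]
    congr 1
    have : -min a c - -max a c = |a - c| := by rw [abs_sub_comm, ← max_sub_min_eq_abs]; ring
    rw [this]; ring
  · intro t ht
    have h1 : max a c ≤ 1 := max_le ha.2 hc.2
    have h2 : -1 ≤ min a c := le_min ha.1 hc.1
    exact ⟨by linarith [ht.1], by linarith [ht.2]⟩

lemma int_abs_sin (s : ℝ) : ∫ b in (0:ℝ)..(2*π), |Real.sin (s + b)| = 4 := by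
  have hp : Function.Periodic (fun x => |Real.sin x|) (2*π) := by
    intro x; simp
  have h1 : ∫ b in (0:ℝ)..(2*π), |Real.sin (s + b)| = ∫ b in s..(s + 2*π), |Real.sin b| := by
    rw [intervalIntegral.integral_comp_add_left (fun x => |Real.sin x|)]; simp
  rw [h1, hp.intervalIntegral_add_eq s 0, zero_add]
  have hc : Continuous (fun x => |Real.sin x|) := by fun_prop
  rw [← intervalIntegral.integral_add_adjacent_intervals (b := π) (hc.intervalIntegrable _ _) (hc.intervalIntegrable _ _)]
  have h2 : ∫ x in (0:ℝ)..π, |Real.sin x| = 2 := by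
    rw [intervalIntegral.integral_congr (g := Real.sin), integral_sin]
    · norm_num
    · intro x hx
      rw [Set.uIcc_of_le pi_pos.le] at hx
      exact abs_of_nonneg (Real.sin_nonneg_of_nonneg_of_le_pi hx.1 hx.2)
  have h3 : ∫ x in π..(2*π), |Real.sin x| = 2 := by
    have := intervalIntegral.integral_comp_add_right (a := 0) (b := π) (fun x => |Real.sin x|) π
    simp only [Real.sin_add_pi, abs_neg, h2] at this
    rw [zero_add, ← two_mul] at this
    exact this.symm
  rw [h2, h3]; norm_num

lemma b_int (x y : ℝ) :
    ∫⁻ b, ENNReal.ofReal (|Real.cos (x + b) - Real.cos (y + b)| / 2) ∂(unifIcc 0 (2*π)) =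
      ENNReal.ofReal (2 / π * |Real.sin ((x - y) / 2)|) := by
  have hpi := pi_pos
  rw [unifIcc, lintegral_smul_measure, smul_eq_mul, ← ofReal_integral_eq_lintegral_ofReal,
    integral_Icc_eq_integral_Ioc, ← intervalIntegral.integral_of_le (by positivity), sub_zero,
    ← ENNReal.ofReal_inv_of_pos (by positivity), ← ENNReal.ofReal_mul (by positivity)]
  · congr 1
    have : ∀ b, |Real.cos (x + b) - Real.cos (y + b)| / 2 = |Real.sin ((x - y)/2)| * |Real.sin ((x+y)/2 + b)| := by
      intro b
      rw [Real.cos_sub_cos, abs_mul, abs_mul, abs_neg, abs_two]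
      have e1 : (x + b + (y + b)) / 2 = (x+y)/2 + b := by ring
      have e2 : (x + b - (y + b)) / 2 = (x-y)/2 := by ring
      rw [e1, e2]; ring
    simp_rw [this]
    rw [intervalIntegral.integral_const_mul, int_abs_sin]
    field_simp
    ring
  · apply Continuous.integrableOn_Icc; fun_prop
  · exact ae_of_all _ fun b => by positivity

lemma fubini_aux {α β : Type} [MeasurableSpace α] [MeasurableSpace β]
    (μ : Measure α) (ν : Measure β) [IsProbabilityMeasure μ] [IsProbabilityMeasure ν]
    (b t : Measure ℝ) [IsProbabilityMeasure b] [IsProbabilityMeasure t]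
    (F1 F2 : α → β → ℝ → ℝ → ENNReal)
    (h1 : Measurable fun p : α × β × ℝ × ℝ => F1 p.1 p.2.1 p.2.2.1 p.2.2.2)
    (h2 : Measurable fun p : α × β × ℝ × ℝ => F2 p.1 p.2.1 p.2.2.1 p.2.2.2) :
    ∫⁻ p, F1 p.1 p.2.1 p.2.2.2.1 p.2.2.2.2.2.1 * F2 p.1 p.2.2.1 p.2.2.2.2.1 p.2.2.2.2.2.2
      ∂(μ.prod (ν.prod (ν.prod (b.prod (b.prod (t.prod t)))))) =
    ∫⁻ w, (∫⁻ v, ∫⁻ b, ∫⁻ t, F1 w v b t ∂t ∂b ∂ν) * (∫⁻ v, ∫⁻ b, ∫⁻ t, F2 w v b t ∂t ∂b ∂ν) ∂μ := by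
  have g1 : ∀ {γ : Type} [MeasurableSpace γ] (f1 : γ → α) (f2 : γ → β) (f3 f4 : γ → ℝ), Measurable f1 → Measurable f2 → Measurable f3 → Measurable f4 →
      Measurable (fun x => F1 (f1 x) (f2 x) (f3 x) (f4 x)) := fun f1 f2 f3 f4 m1 m2 m3 m4 =>
    h1.comp (m1.prodMk (m2.prodMk (m3.prodMk m4)))
  have g2 : ∀ {γ : Type} [MeasurableSpace γ] (f1 : γ → α) (f2 : γ → β) (f3 f4 : γ → ℝ), Measurable f1 → Measurable f2 → Measurable f3 → Measurable f4 →
      Measurable (fun x => F2 (f1 x) (f2 x) (f3 x) (f4 x)) := fun f1 f2 f3 f4 m1 m2 m3 m4 =>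
    h2.comp (m1.prodMk (m2.prodMk (m3.prodMk m4)))
  have k1 : ∀ w v, Measurable fun b => ∫⁻ t, F1 w v b t ∂t := fun w v =>
    (g1 (fun _ => w) (fun _ => v) (Prod.fst : ℝ × ℝ → ℝ) Prod.snd (by fun_prop) (by fun_prop) (by fun_prop) (by fun_prop)).lintegral_prod_right
  have k2 : ∀ w v, Measurable fun b => ∫⁻ t, F2 w v b t ∂t := fun w v =>
    (g2 (fun _ => w) (fun _ => v) (Prod.fst : ℝ × ℝ → ℝ) Prod.snd (by fun_prop) (by fun_prop) (by fun_prop) (by fun_prop)).lintegral_prod_right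
  have l1 : ∀ w, Measurable fun v => ∫⁻ b, ∫⁻ t, F1 w v b t ∂t ∂b := fun w => by
    have : Measurable (fun p : β × ℝ => ∫⁻ t, F1 w p.1 p.2 t ∂t) :=
      (g1 (fun _ => w) (fun p : (β × ℝ) × ℝ => p.1.1) (fun p => p.1.2) (fun p => p.2) (by fun_prop) (by fun_prop) (by fun_prop) (by fun_prop)).lintegral_prod_right
    exact this.lintegral_prod_right
  have l2 : ∀ w, Measurable fun v => ∫⁻ b, ∫⁻ t, F2 w v b t ∂t ∂b := fun w => by
    have : Measurable (fun p : β × ℝ => ∫⁻ t, F2 w p.1 p.2 t ∂t) :=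
      (g2 (fun _ => w) (fun p : (β × ℝ) × ℝ => p.1.1) (fun p => p.1.2) (fun p => p.2) (by fun_prop) (by fun_prop) (by fun_prop) (by fun_prop)).lintegral_prod_right
    exact this.lintegral_prod_right
  rw [lintegral_prod]
  swap
  · refine Measurable.aemeasurable (Measurable.mul (g1 _ _ _ _ ?_ ?_ ?_ ?_) (g2 _ _ _ _ ?_ ?_ ?_ ?_)) <;> fun_prop
  refine lintegral_congr fun w => ?_
  rw [lintegral_prod]
  swap
  · refine Measurable.aemeasurable (Measurable.mul (g1 _ _ _ _ ?_ ?_ ?_ ?_) (g2 _ _ _ _ ?_ ?_ ?_ ?_)) <;> fun_prop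
  rw [← lintegral_mul_const _ (l1 w)]
  refine lintegral_congr fun v1 => ?_
  rw [lintegral_prod]
  swap
  · refine Measurable.aemeasurable (Measurable.mul (g1 _ _ _ _ ?_ ?_ ?_ ?_) (g2 _ _ _ _ ?_ ?_ ?_ ?_)) <;> fun_prop
  rw [← lintegral_const_mul _ (l2 w)]
  refine lintegral_congr fun v2 => ?_
  rw [lintegral_prod]
  swap
  · refine Measurable.aemeasurable (Measurable.mul (g1 _ _ _ _ ?_ ?_ ?_ ?_) (g2 _ _ _ _ ?_ ?_ ?_ ?_)) <;> fun_prop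
  rw [← lintegral_mul_const _ (k1 w v1)]
  refine lintegral_congr fun b1 => ?_
  rw [lintegral_prod]
  swap
  · refine Measurable.aemeasurable (Measurable.mul (g1 _ _ _ _ ?_ ?_ ?_ ?_) (g2 _ _ _ _ ?_ ?_ ?_ ?_)) <;> fun_prop
  rw [← lintegral_const_mul _ (k2 w v2)]
  refine lintegral_congr fun b2 => ?_
  exact lintegral_prod_mul (f := fun t => F1 w v1 b1 t) (g := fun t => F2 w v2 b2 t)
    (g1 (γ := ℝ) (fun _ => w) (fun _ => v1) (fun _ => b1) (fun t => t)
      (by fun_prop) (by fun_prop) (by fun_prop) (by fun_prop)).aemeasurable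
    (g2 (γ := ℝ) (fun _ => w) (fun _ => v2) (fun _ => b2) (fun t => t)
      (by fun_prop) (by fun_prop) (by fun_prop) (by fun_prop)).aemeasurable

lemma hasSum_int_bdd {α ι : Type*} [MeasurableSpace α] [Countable ι] (μ : Measure α) [IsProbabilityMeasure μ]
    (f : ι → α → ℝ) (c : ι → ℝ) (hf : ∀ i, Measurable (f i)) (hb : ∀ i x, |f i x| ≤ c i) (hc : Summable c) :
    HasSum (fun i => ∫ x, f i x ∂μ) (∫ x, ∑' i, f i x ∂μ) := by
  have hi : ∀ i, Integrable (f i) μ := fun i =>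
    Integrable.of_bound (C := c i) (hf i).aestronglyMeasurable (ae_of_all _ (hb i))
  refine hasSum_integral_of_summable_integral_norm hi ?_
  refine Summable.of_nonneg_of_le (fun i => integral_nonneg fun x => norm_nonneg _) (fun i => ?_) hc
  calc ∫ x, ‖f i x‖ ∂μ ≤ ∫ x, c i ∂μ := integral_mono (hi i).norm (integrable_const _) (hb i)
    _ = c i := by simp

noncomputable def hS {d e : ℕ} (Z : Matrix (Fin d) (Fin e) ℝ) (w : Fin d → ℝ) : ℝ :=
  ∑' m : ℕ+, Real.exp (-((w ᵥ* ((m:ℝ) • Z)) ⬝ᵥ (w ᵥ* ((m:ℝ) • Z))) / 2) * (1 / (4 * (m:ℝ)^2 - 1))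

lemma dot_self_nonneg' {e : ℕ} (u : Fin e → ℝ) : 0 ≤ u ⬝ᵥ u :=
  Finset.sum_nonneg fun i _ => mul_self_nonneg _

lemma v_int {d e : ℕ} (Z : Matrix (Fin d) (Fin e) ℝ) (w : Fin d → ℝ) :
    ∫ v, 2 / π * |Real.sin ((w ⬝ᵥ (Z *ᵥ v)) / 2)| ∂(_root_.stdGaussian e) = 4 / π^2 - 8 / π^2 * hS Z w := by
  have hpi := pi_pos
  have h := hasSum_int_bdd (_root_.stdGaussian e)
    (fun (m : ℕ+) v => Real.cos (m * (w ⬝ᵥ (Z *ᵥ v))) / (4 * (m:ℝ)^2 - 1)) (fun m => 1 / (4 * (m:ℝ)^2 - 1))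
    (fun m => by
      apply Continuous.measurable
      unfold dotProduct Matrix.mulVec dotProduct
      fun_prop)
    (fun m v => by
      rw [abs_div, abs_of_pos (den_pos m)]
      exact div_le_div_of_nonneg_right (Real.abs_cos_le_one _) (den_pos m).le) summ_pnat
  have h1 : ∀ m : ℕ+, ∫ v, Real.cos (m * (w ⬝ᵥ (Z *ᵥ v))) / (4 * (m:ℝ)^2 - 1) ∂(_root_.stdGaussian e)
      = Real.exp (-((w ᵥ* ((m:ℝ) • Z)) ⬝ᵥ (w ᵥ* ((m:ℝ) • Z))) / 2) * (1 / (4 * (m:ℝ)^2 - 1)) := by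
    intro m
    rw [integral_div, ← gauss_cos, div_eq_mul_one_div]
    congr 3
    ext v
    rw [← Matrix.dotProduct_mulVec, Matrix.smul_mulVec, dotProduct_smul, smul_eq_mul]
  simp_rw [h1] at h
  have h2 := h.tsum_eq
  simp_rw [fun x => (fourier_abs_sin x).tsum_eq] at h2
  have hint : Integrable (fun v => π / 4 * |Real.sin ((w ⬝ᵥ (Z *ᵥ v)) / 2)|) (_root_.stdGaussian e) := by
    refine Integrable.of_bound (C := π/4) ?_ (ae_of_all _ fun v => ?_)
    · apply Continuous.aestronglyMeasurable
      unfold dotProduct Matrix.mulVec dotProduct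
      fun_prop
    · rw [Real.norm_of_nonneg (by positivity)]
      have := Real.abs_sin_le_one ((w ⬝ᵥ (Z *ᵥ v)) / 2)
      nlinarith
  rw [integral_sub (integrable_const _) hint] at h2
  simp only [integral_const, integral_const_mul] at h2
  unfold hS
  rw [h2, integral_const_mul]
  simp
  field_simp
  ring

noncomputable def dF {d e : ℕ} (X Y : Matrix (Fin d) (Fin e) ℝ) (w : Fin d → ℝ) (v : Fin e → ℝ) (b t : ℝ) : ENNReal :=
  Set.indicator {t | sgn01 (Real.cos (w ⬝ᵥ (X *ᵥ v) + b) + t) ≠ sgn01 (Real.cos (w ⬝ᵥ (Y *ᵥ v) + b) + t)} 1 t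

lemma bil_meas {d e : ℕ} (X : Matrix (Fin d) (Fin e) ℝ) :
    Measurable fun p : (Fin d → ℝ) × (Fin e → ℝ) × ℝ × ℝ => sgn01 (Real.cos (p.1 ⬝ᵥ (X *ᵥ p.2.1) + p.2.2.1) + p.2.2.2) := by
  apply sgn01_meas.comp
  apply Continuous.measurable
  unfold dotProduct Matrix.mulVec dotProduct
  fun_prop

lemma dF_set_meas {d e : ℕ} (X Y : Matrix (Fin d) (Fin e) ℝ) :
    MeasurableSet {p : (Fin d → ℝ) × (Fin e → ℝ) × ℝ × ℝ | sgn01 (Real.cos (p.1 ⬝ᵥ (X *ᵥ p.2.1) + p.2.2.1) + p.2.2.2) ≠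
      sgn01 (Real.cos (p.1 ⬝ᵥ (Y *ᵥ p.2.1) + p.2.2.1) + p.2.2.2)} :=
  (measurableSet_eq_fun (bil_meas X) (bil_meas Y)).compl

lemma dF_meas {d e : ℕ} (X Y : Matrix (Fin d) (Fin e) ℝ) :
    Measurable fun p : (Fin d → ℝ) × (Fin e → ℝ) × ℝ × ℝ => dF X Y p.1 p.2.1 p.2.2.1 p.2.2.2 :=
  measurable_one.indicator (dF_set_meas X Y)

lemma dF_int {d e : ℕ} (X Y : Matrix (Fin d) (Fin e) ℝ) (w : Fin d → ℝ) :
    ∫⁻ v, ∫⁻ b, ∫⁻ t, dF X Y w v b t ∂(unifIcc (-1) 1) ∂(unifIcc 0 (2*π)) ∂(_root_.stdGaussian e) =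
      ENNReal.ofReal (4 / π^2 - 8 / π^2 * hS (X - Y) w) := by
  have hpi := pi_pos
  have h1 : ∀ v b, ∫⁻ t, dF X Y w v b t ∂(unifIcc (-1) 1) =
      ENNReal.ofReal (|Real.cos (w ⬝ᵥ (X *ᵥ v) + b) - Real.cos (w ⬝ᵥ (Y *ᵥ v) + b)| / 2) := by
    intro v b
    unfold dF
    rw [lintegral_indicator_one, t_int _ _ (Real.abs_cos_le_one _) (Real.abs_cos_le_one _)]
    rw [sgn_set]; exact measurableSet_Ico
  simp_rw [h1, b_int]
  have h2 : ∀ v, w ⬝ᵥ (X *ᵥ v) - w ⬝ᵥ (Y *ᵥ v) = w ⬝ᵥ ((X - Y) *ᵥ v) := by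
    intro v; rw [Matrix.sub_mulVec, dotProduct_sub]
  simp_rw [h2]
  rw [← v_int, ofReal_integral_eq_lintegral_ofReal]
  · refine Integrable.of_bound (C := 2/π) ?_ (ae_of_all _ fun v => ?_)
    · apply Continuous.aestronglyMeasurable
      unfold dotProduct Matrix.mulVec dotProduct
      fun_prop
    · rw [Real.norm_of_nonneg (by positivity)]
      exact mul_le_of_le_one_right (by positivity) (Real.abs_sin_le_one _)
  · exact ae_of_all _ fun v => by positivity

lemma term_meas {d e : ℕ} (Z : Matrix (Fin d) (Fin e) ℝ) :
    Measurable fun w : Fin d → ℝ => Real.exp (-((w ᵥ* Z) ⬝ᵥ (w ᵥ* Z)) / 2) := by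
  apply Continuous.measurable
  unfold Matrix.vecMul dotProduct
  fun_prop

lemma exp_le_one' {e : ℕ} (u : Fin e → ℝ) : Real.exp (-(u ⬝ᵥ u) / 2) ≤ 1 :=
  Real.exp_le_one_iff.mpr (by linarith [dot_self_nonneg' u])

lemma term_summ {d e : ℕ} (Z : Matrix (Fin d) (Fin e) ℝ) (w : Fin d → ℝ) :
    Summable fun m : ℕ+ => Real.exp (-((w ᵥ* ((m:ℝ) • Z)) ⬝ᵥ (w ᵥ* ((m:ℝ) • Z))) / 2) * (1 / (4 * (m:ℝ)^2 - 1)) :=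
  Summable.of_nonneg_of_le (fun m => mul_nonneg (Real.exp_pos _).le (one_div_nonneg.mpr (den_pos m).le))
    (fun m => mul_le_of_le_one_left (one_div_nonneg.mpr (den_pos m).le) (exp_le_one' _)) summ_pnat

lemma hS_nonneg {d e : ℕ} (Z : Matrix (Fin d) (Fin e) ℝ) (w : Fin d → ℝ) : 0 ≤ hS Z w :=
  tsum_nonneg (fun m => mul_nonneg (Real.exp_pos _).le (one_div_nonneg.mpr (den_pos m).le))

lemma hS_le {d e : ℕ} (Z : Matrix (Fin d) (Fin e) ℝ) (w : Fin d → ℝ) : hS Z w ≤ 1/2 := by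
  have h := (fourier_abs_sin 0)
  simp only [mul_zero, Real.cos_zero, zero_div, Real.sin_zero, abs_zero, sub_zero] at h
  rw [← h.tsum_eq]
  exact (term_summ Z w).tsum_le_tsum (fun m => mul_le_of_le_one_left (one_div_nonneg.mpr (den_pos m).le) (exp_le_one' _)) summ_pnat

lemma hS_meas {d e : ℕ} (Z : Matrix (Fin d) (Fin e) ℝ) : Measurable (hS Z) := by
  unfold hS
  exact Measurable.tsum (fun m => (term_meas _).mul_const _)

lemma ES {d e : ℕ} (Z : Matrix (Fin d) (Fin e) ℝ) :
    HasSum (fun m : ℕ+ => kb ((m:ℝ) • Z) * (1 / (4 * (m:ℝ)^2 - 1))) (∫ w, hS Z w ∂(_root_.stdGaussian d)) := by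
  have := hasSum_int_bdd (_root_.stdGaussian d)
    (fun (m : ℕ+) w => Real.exp (-((w ᵥ* ((m:ℝ) • Z)) ⬝ᵥ (w ᵥ* ((m:ℝ) • Z))) / 2) * (1 / (4 * (m:ℝ)^2 - 1)))
    (fun m => 1 / (4 * (m:ℝ)^2 - 1)) (fun m => (term_meas _).mul_const _)
    (fun m w => by
      have := one_div_pos.mpr (den_pos m)
      rw [abs_of_nonneg (by positivity)]
      exact mul_le_of_le_one_left this.le (exp_le_one' _)) summ_pnat
  simp_rw [integral_mul_const, gauss_quad] at this
  exact this

lemma summ_pp : Summable (fun p : ℕ+ × ℕ+ => (1 / (4 * (p.1:ℝ)^2 - 1)) * (1 / (4 * (p.2:ℝ)^2 - 1))) :=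
  summ_pnat.mul_of_nonneg summ_pnat (fun m => one_div_nonneg.mpr (den_pos m).le) (fun m => one_div_nonneg.mpr (den_pos m).le)

lemma exp_comb {d e : ℕ} (Z : Matrix (Fin d) (Fin e) ℝ) (w : Fin d → ℝ) (m n : ℝ) :
    Real.exp (-((w ᵥ* (m • Z)) ⬝ᵥ (w ᵥ* (m • Z))) / 2) * Real.exp (-((w ᵥ* (n • Z)) ⬝ᵥ (w ᵥ* (n • Z))) / 2) =
    Real.exp (-((w ᵥ* (√(m^2+n^2) • Z)) ⬝ᵥ (w ᵥ* (√(m^2+n^2) • Z))) / 2) := by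
  rw [← Real.exp_add]
  congr 1
  simp only [Matrix.vecMul_smul, dotProduct_smul, smul_dotProduct, smul_eq_mul]
  have := Real.mul_self_sqrt (show 0 ≤ m^2+n^2 by positivity)
  linear_combination (w ᵥ* Z ⬝ᵥ w ᵥ* Z) / 2 * this

lemma ES2 {d e : ℕ} (Z : Matrix (Fin d) (Fin e) ℝ) :
    HasSum (fun p : ℕ+ × ℕ+ => kb (√((p.1:ℝ)^2 + (p.2:ℝ)^2) • Z) * ((1 / (4 * (p.1:ℝ)^2 - 1)) * (1 / (4 * (p.2:ℝ)^2 - 1))))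
      (∫ w, (hS Z w)^2 ∂(_root_.stdGaussian d)) := by
  have := hasSum_int_bdd (_root_.stdGaussian d)
    (fun (p : ℕ+ × ℕ+) w => Real.exp (-((w ᵥ* (√((p.1:ℝ)^2 + (p.2:ℝ)^2) • Z)) ⬝ᵥ (w ᵥ* (√((p.1:ℝ)^2 + (p.2:ℝ)^2) • Z))) / 2)
      * ((1 / (4 * (p.1:ℝ)^2 - 1)) * (1 / (4 * (p.2:ℝ)^2 - 1))))
    (fun p => (1 / (4 * (p.1:ℝ)^2 - 1)) * (1 / (4 * (p.2:ℝ)^2 - 1))) (fun m => (term_meas _).mul_const _)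
    (fun p w => by
      have h1 := one_div_pos.mpr (den_pos p.1)
      have h2 := one_div_pos.mpr (den_pos p.2)
      rw [abs_of_nonneg (by positivity)]
      exact mul_le_of_le_one_left (by positivity) (exp_le_one' _)) summ_pp
  simp_rw [integral_mul_const, gauss_quad] at this
  convert! this using 2
  ext w
  rw [pow_two, hS, tsum_mul_tsum_of_summable_norm (term_summ Z w).norm (term_summ Z w).norm]
  refine tsum_congr fun p => ?_
  rw [← exp_comb]
  ring

lemma joint_prob {d e : ℕ} (X Y : Matrix (Fin d) (Fin e) ℝ) :
    (hashLaw2 d e {p | hashBit1 X p ≠ hashBit1 Y p ∧ hashBit2 X p ≠ hashBit2 Y p}).toReal =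
      ∫ w, (4 / π^2 - 8 / π^2 * hS (X - Y) w)^2 ∂(_root_.stdGaussian d) := by
  have hm := dF_meas X Y
  have hset : MeasurableSet {p | hashBit1 X p ≠ hashBit1 Y p ∧ hashBit2 X p ≠ hashBit2 Y p} := by
    refine MeasurableSet.inter ?_ ?_
    · exact (dF_set_meas X Y).preimage (f := fun p : (Fin d → ℝ) × (Fin e → ℝ) × (Fin e → ℝ) × ℝ × ℝ × ℝ × ℝ => (p.1, p.2.1, p.2.2.2.1, p.2.2.2.2.2.1)) (by fun_prop)
    · exact (dF_set_meas X Y).preimage (f := fun p : (Fin d → ℝ) × (Fin e → ℝ) × (Fin e → ℝ) × ℝ × ℝ × ℝ × ℝ => (p.1, p.2.2.1, p.2.2.2.2.1, p.2.2.2.2.2.2)) (by fun_prop)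
  rw [← lintegral_indicator_one hset]
  have := fubini_aux (_root_.stdGaussian d) (_root_.stdGaussian e) (unifIcc 0 (2*π)) (unifIcc (-1) 1) (dF X Y) (dF X Y) hm hm
  simp_rw [dF_int] at this
  have h0 : ∀ w, 0 ≤ 4 / π^2 - 8 / π^2 * hS (X - Y) w := fun w => by
    have := hS_le (X - Y) w
    have : 8 / π^2 * hS (X - Y) w ≤ 8 / π^2 * (1/2) := by gcongr
    linarith [show 8 / π^2 * (1/2) = 4 / π^2 by ring]
  simp_rw [← ENNReal.ofReal_mul (h0 _), ← pow_two] at this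
  rw [integral_eq_lintegral_of_nonneg_ae (ae_of_all _ fun w => by positivity)
    (by have := hS_meas (X - Y); fun_prop)]
  rw [← this]
  congr 1
  unfold hashLaw2
  refine lintegral_congr fun p => ?_
  simp only [dF, Set.indicator_apply, hashBit1, hashBit2, Set.mem_ofPred_eq, Pi.one_apply]
  split_ifs <;> simp_all

lemma single_prob1 {d e : ℕ} (X Y : Matrix (Fin d) (Fin e) ℝ) :
    (hashLaw2 d e {p | hashBit1 X p ≠ hashBit1 Y p}).toReal =
      ∫ w, (4 / π^2 - 8 / π^2 * hS (X - Y) w) ∂(_root_.stdGaussian d) := by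
  have hm := dF_meas X Y
  have hset : MeasurableSet {p | hashBit1 X p ≠ hashBit1 Y p} := 
    (dF_set_meas X Y).preimage (f := fun p : (Fin d → ℝ) × (Fin e → ℝ) × (Fin e → ℝ) × ℝ × ℝ × ℝ × ℝ => (p.1, p.2.1, p.2.2.2.1, p.2.2.2.2.2.1)) (by fun_prop)
  rw [← lintegral_indicator_one hset]
  have := fubini_aux (_root_.stdGaussian d) (_root_.stdGaussian e) (unifIcc 0 (2*π)) (unifIcc (-1) 1) (dF X Y) (fun _ _ _ _ => 1) hm measurable_const
  simp_rw [dF_int] at this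
  have h0 : ∀ w, 0 ≤ 4 / π^2 - 8 / π^2 * hS (X - Y) w := fun w => by
    have := hS_le (X - Y) w
    have : 8 / π^2 * hS (X - Y) w ≤ 8 / π^2 * (1/2) := by gcongr
    linarith [show 8 / π^2 * (1/2) = 4 / π^2 by ring]
  simp only [lintegral_const, measure_univ, mul_one] at this
  rw [integral_eq_lintegral_of_nonneg_ae (ae_of_all _ h0)
    (by have := hS_meas (X - Y); fun_prop)]
  rw [← this]
  rfl

lemma single_prob2 {d e : ℕ} (X Y : Matrix (Fin d) (Fin e) ℝ) :
    (hashLaw2 d e {p | hashBit2 X p ≠ hashBit2 Y p}).toReal =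
      ∫ w, (4 / π^2 - 8 / π^2 * hS (X - Y) w) ∂(_root_.stdGaussian d) := by
  have hm := dF_meas X Y
  have hset : MeasurableSet {p | hashBit2 X p ≠ hashBit2 Y p} := 
    (dF_set_meas X Y).preimage (f := fun p : (Fin d → ℝ) × (Fin e → ℝ) × (Fin e → ℝ) × ℝ × ℝ × ℝ × ℝ => (p.1, p.2.2.1, p.2.2.2.2.1, p.2.2.2.2.2.2)) (by fun_prop)
  rw [← lintegral_indicator_one hset]
  have := fubini_aux (_root_.stdGaussian d) (_root_.stdGaussian e) (unifIcc 0 (2*π)) (unifIcc (-1) 1) (fun _ _ _ _ => 1) (dF X Y) measurable_const hm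
  simp_rw [dF_int] at this
  have h0 : ∀ w, 0 ≤ 4 / π^2 - 8 / π^2 * hS (X - Y) w := fun w => by
    have := hS_le (X - Y) w
    have : 8 / π^2 * hS (X - Y) w ≤ 8 / π^2 * (1/2) := by gcongr
    linarith [show 8 / π^2 * (1/2) = 4 / π^2 by ring]
  simp only [lintegral_const, measure_univ, one_mul] at this
  rw [integral_eq_lintegral_of_nonneg_ae (ae_of_all _ h0)
    (by have := hS_meas (X - Y); fun_prop)]
  rw [← this]
  rfl

lemma var_eq {dw dv : ℕ} (Z : Matrix (Fin dw) (Fin dv) ℝ) :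
    (∫ w, (4 / π^2 - 8 / π^2 * hS Z w)^2 ∂(_root_.stdGaussian dw)) -
      (∫ w, (4 / π^2 - 8 / π^2 * hS Z w) ∂(_root_.stdGaussian dw)) *
      (∫ w, (4 / π^2 - 8 / π^2 * hS Z w) ∂(_root_.stdGaussian dw)) =
    64 / π^4 * ((∫ w, (hS Z w)^2 ∂(_root_.stdGaussian dw)) -
        ((∫ w, hS Z w ∂(_root_.stdGaussian dw)) * (∫ w, hS Z w ∂(_root_.stdGaussian dw)))) := by
  have hpi := pi_pos
  have hm := hS_meas Z
  have i1 : Integrable (hS Z) (_root_.stdGaussian dw) :=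
    Integrable.of_bound (C := 1/2) hm.aestronglyMeasurable
      (ae_of_all _ fun w => by rw [Real.norm_of_nonneg (hS_nonneg Z w)]; exact hS_le Z w)
  have i2 : Integrable (fun w => (hS Z w)^2) (_root_.stdGaussian dw) :=
    Integrable.of_bound (C := (1/2)^2) (hm.pow_const 2).aestronglyMeasurable
      (ae_of_all _ fun w => by
        rw [Real.norm_of_nonneg (by positivity)]
        exact pow_le_pow_left₀ (hS_nonneg Z w) (hS_le Z w) 2)
  have e1 : ∫ w, (4 / π^2 - 8 / π^2 * hS Z w) ∂(_root_.stdGaussian dw) =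
      4 / π^2 - 8 / π^2 * ∫ w, hS Z w ∂(_root_.stdGaussian dw) := by
    rw [integral_sub (integrable_const _) (i1.const_mul _), integral_const_mul]
    simp
  have e2 : ∫ w, (4 / π^2 - 8 / π^2 * hS Z w)^2 ∂(_root_.stdGaussian dw) =
      16 / π^4 - 64 / π^4 * ∫ w, hS Z w ∂(_root_.stdGaussian dw)
        + 64 / π^4 * ∫ w, (hS Z w)^2 ∂(_root_.stdGaussian dw) := by
    have : ∀ w, (4 / π^2 - 8 / π^2 * hS Z w)^2 = (16 / π^4 - 64 / π^4 * hS Z w) + 64 / π^4 * (hS Z w)^2 := by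
      intro w; ring
    simp_rw [this]
    have i3 : Integrable (fun w => 16 / π^4 - 64 / π^4 * hS Z w) (_root_.stdGaussian dw) :=
      (integrable_const _).sub (i1.const_mul _)
    rw [integral_add i3 (i2.const_mul _),
      integral_sub (integrable_const _) (i1.const_mul _), integral_const_mul, integral_const_mul]
    simp
  rw [e1, e2]
  ring

lemma hasSum_mul_self (f : ℕ+ → ℝ) (a : ℝ) (h : HasSum f a) :
    HasSum (fun p : ℕ+ × ℕ+ => f p.1 * f p.2) (a * a) :=
  h.mul h (summable_mul_of_summable_norm (f := f) (g := f) h.summable.norm h.summable.norm)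

lemma key_eq {dw dv : ℕ} (Z : Matrix (Fin dw) (Fin dv) ℝ) :
    ∑' m : ℕ+, ∑' n : ℕ+,
          (kb (Real.sqrt ((m : ℝ) ^ 2 + (n : ℝ) ^ 2) • Z) -
              kb ((m : ℝ) • Z) * kb ((n : ℝ) • Z)) /
            ((4 * (m : ℝ) ^ 2 - 1) * (4 * (n : ℝ) ^ 2 - 1)) =
      (∫ w, (hS Z w)^2 ∂(_root_.stdGaussian dw)) -
        ((∫ w, hS Z w ∂(_root_.stdGaussian dw)) * (∫ w, hS Z w ∂(_root_.stdGaussian dw))) := by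
  have hP : HasSum (fun p : ℕ+ × ℕ+ => (kb ((p.1:ℝ) • Z) * (1 / (4 * (p.1:ℝ)^2 - 1))) * (kb ((p.2:ℝ) • Z) * (1 / (4 * (p.2:ℝ)^2 - 1))))
      ((∫ w, hS Z w ∂(_root_.stdGaussian dw)) * (∫ w, hS Z w ∂(_root_.stdGaussian dw))) :=
    hasSum_mul_self (fun m : ℕ+ => kb ((m:ℝ) • Z) * (1 / (4 * (m:ℝ)^2 - 1))) _ (ES Z)
  have hD := (ES2 Z).sub hP
  have hE : HasSum (fun p : ℕ+ × ℕ+ => (kb (Real.sqrt ((p.1 : ℝ) ^ 2 + (p.2 : ℝ) ^ 2) • Z) -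
      kb ((p.1 : ℝ) • Z) * kb ((p.2 : ℝ) • Z)) / ((4 * (p.1 : ℝ) ^ 2 - 1) * (4 * (p.2 : ℝ) ^ 2 - 1)))
      ((∫ w, (hS Z w)^2 ∂(_root_.stdGaussian dw)) -
        ((∫ w, hS Z w ∂(_root_.stdGaussian dw)) * (∫ w, hS Z w ∂(_root_.stdGaussian dw)))) := by
    refine hD.congr_fun fun p => ?_
    generalize kb (Real.sqrt ((p.1 : ℝ) ^ 2 + (p.2 : ℝ) ^ 2) • Z) = k1
    generalize kb ((p.1 : ℝ) • Z) = k2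
    generalize kb ((p.2 : ℝ) • Z) = k3
    simp only [div_eq_mul_inv, mul_inv]
    ring
  rw [← hE.tsum_eq]
  exact hE.summable.tsum_prod.symm

/-- Series formula for the covariance between two bits sharing the left projection. -/
theorem bit_covariance_formula {dw dv : ℕ} (hdw : 0 < dw) (hdv : 0 < dv)
    (X Y : Matrix (Fin dw) (Fin dv) ℝ) :
    bitCov X Y =
      64 / π ^ 4 *
        ∑' m : ℕ+, ∑' n : ℕ+,
          (kb (Real.sqrt ((m : ℝ) ^ 2 + (n : ℝ) ^ 2) • (X - Y)) -
              kb ((m : ℝ) • (X - Y)) * kb ((n : ℝ) • (X - Y))) /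
            ((4 * (m : ℝ) ^ 2 - 1) * (4 * (n : ℝ) ^ 2 - 1)) := by
  rw [bitCov, joint_prob, single_prob1, single_prob2, key_eq, var_eq]
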